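/- If α > 0, A > 0 and α + A < 2/(3√3) (region R₁), then for every ε > 0 the deterministic equation ẋ = (1/ε)(x − x³ + α + A cos(2πt)) has two distinct 1-periodic solutions x_l* and x_u* with x_l*(t) < x_u*(t) for all t, each of which is stable: each satisfies ∫_0^1 (1 − 3 x*(t)²) dt < 0, so its Floquet multiplier exp((1/ε)∫_0^1 f_x(x*(t),t) dt) is strictly less than 1. -/

import Mathlib

open MeasureTheory Real Set Filter

/-- The drift `f(x,t) = x - x³ + α + A cos(2πt)`. -/
noncomputable def fdrift (α A : ℝ) (x t : ℝ) : ℝ :=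
  x - x ^ 3 + α + A * Real.cos (2 * Real.pi * t)

/-- A differentiable periodic function attains its maximum, at a critical point. -/
theorem Function.Periodic.exists_forall_le_of_hasDerivAt {x x' : ℝ → ℝ}
    (hx : Function.Periodic x 1) (hd : ∀ t, HasDerivAt x (x' t) t) :
    ∃ t₀, (∀ t, x t ≤ x t₀) ∧ x' t₀ = 0 := by
  have hc : Continuous x := continuous_iff_continuousAt.2 fun t => (hd t).continuousAt
  obtain ⟨t₀, -, ht₀⟩ := isCompact_Icc.exists_isMaxOn
    (nonempty_Icc.2 (zero_le_one (α := ℝ))) hc.continuousOn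
  have hmax : ∀ t, x t ≤ x t₀ := fun t => by
    obtain ⟨u, hu, hxu⟩ := hx.exists_mem_Ico₀ one_pos t
    rw [hxu]
    exact ht₀ (Ico_subset_Icc_self hu)
  exact ⟨t₀, hmax, IsLocalMax.hasDerivAt_eq_zero (Eventually.of_forall hmax) (hd t₀)⟩

/-- A differentiable periodic function attains its minimum, at a critical point. -/
theorem Function.Periodic.exists_forall_ge_of_hasDerivAt {x x' : ℝ → ℝ}
    (hx : Function.Periodic x 1) (hd : ∀ t, HasDerivAt x (x' t) t) :
    ∃ t₀, (∀ t, x t₀ ≤ x t) ∧ x' t₀ = 0 := by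
  obtain ⟨t₀, h, h'⟩ := Function.Periodic.exists_forall_le_of_hasDerivAt
    (x := fun t => -x t) (fun t => by simp [hx t]) fun t => (hd t).neg
  exact ⟨t₀, fun t => neg_le_neg_iff.1 (h t), neg_eq_zero.1 h'⟩

/-- The linear equation `x' = -K x + G` with `1`-periodic forcing has a `1`-periodic solution. -/
theorem exists_periodic_solution_linear {K : ℝ} (hK : 0 < K) {G : ℝ → ℝ} (hG : Continuous G)
    (hp : Function.Periodic G 1) :
    ∃ x : ℝ → ℝ, Function.Periodic x 1 ∧ ∀ t, HasDerivAt x (-K * x t + G t) t := by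
  have hc : Continuous fun u => exp (K * u) * G u := by fun_prop
  have hi : ∀ a b, IntervalIntegrable (fun u => exp (K * u) * G u) volume a b :=
    fun a b => hc.intervalIntegrable a b
  have hne : exp K - 1 ≠ 0 := (sub_pos.2 (one_lt_exp_iff.2 hK)).ne'
  refine ⟨fun t => exp (-K * t) * ((exp K - 1)⁻¹ * (∫ u in (0 : ℝ)..1, exp (K * u) * G u) +
    ∫ u in (0 : ℝ)..t, exp (K * u) * G u), fun t => ?_, fun t => ?_⟩
  · have hshift : (∫ u in (1 : ℝ)..(t + 1), exp (K * u) * G u) =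
        exp K * ∫ u in (0 : ℝ)..t, exp (K * u) * G u := by
      rw [← intervalIntegral.integral_const_mul]
      have := intervalIntegral.integral_comp_add_right (a := 0) (b := t)
        (fun u => exp (K * u) * G u) 1
      rw [zero_add] at this
      rw [← this]
      refine intervalIntegral.integral_congr fun u _ => ?_
      simp only [hp u, mul_add, mul_one, exp_add]
      ring
    have hsplit := intervalIntegral.integral_add_adjacent_intervals (hi 0 1) (hi 1 (t + 1))
    have hexp : exp (-K * (t + 1)) = exp (-K * t) * (exp K)⁻¹ := by
      rw [← exp_neg, ← exp_add]
      ring_nf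
    have := (exp_pos K).ne'
    simp only [← hsplit, hshift, hexp]
    field_simp
    ring
  · have hint := intervalIntegral.integral_hasDerivAt_right (hi 0 t)
      (hc.stronglyMeasurableAtFilter _ _) hc.continuousAt
    have hexp : HasDerivAt (fun t => exp (-K * t)) (exp (-K * t) * (-K * 1)) t :=
      ((hasDerivAt_id t).const_mul (-K)).exp
    have hone : exp (-K * t) * exp (K * t) = 1 := by
      rw [← exp_add]
      simp
    refine (hexp.mul (hint.const_add
      ((exp K - 1)⁻¹ * ∫ u in (0 : ℝ)..1, exp (K * u) * G u))).congr_deriv ?_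
    linear_combination G t * hone

/-- Maximum principle: a periodic solution of `x' = -K x + G` is bounded by `C / K` when
`|G| ≤ C`. -/
theorem abs_le_of_periodic_linear {K C : ℝ} (hK : 0 < K) {x G : ℝ → ℝ}
    (hx : Function.Periodic x 1) (hd : ∀ t, HasDerivAt x (-K * x t + G t) t)
    (hG : ∀ t, |G t| ≤ C) (t : ℝ) : |x t| ≤ C / K := by
  obtain ⟨a, ha, ha'⟩ := hx.exists_forall_le_of_hasDerivAt hd
  obtain ⟨b, hb, hb'⟩ := hx.exists_forall_ge_of_hasDerivAt hd
  have h₁ := abs_le.1 (hG a)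
  have h₂ := abs_le.1 (hG b)
  have h₃ := mul_le_mul_of_nonneg_left (ha t) hK.le
  have h₄ := mul_le_mul_of_nonneg_left (hb t) hK.le
  rw [le_div_iff₀ hK]
  nth_rw 1 [← abs_of_pos hK]
  rw [← abs_mul, abs_le]
  constructor <;> nlinarith

/-- If `h` is uniformly decreasing and Lipschitz, then `x' = h x + g t` with `1`-periodic forcing
has a `1`-periodic solution. -/
theorem exists_periodic_solution_of_decreasing {m M : ℝ} (hm : 0 < m) {h g : ℝ → ℝ}
    (hlow : ∀ x y, x ≤ y → m * (y - x) ≤ h x - h y)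
    (hupp : ∀ x y, x ≤ y → h x - h y ≤ M * (y - x))
    (hg : Continuous g) (hp : Function.Periodic g 1) :
    ∃ x : ℝ → ℝ, Function.Periodic x 1 ∧ ∀ t, HasDerivAt x (h (x t) + g t) t := by
  have hmM : m ≤ M := by
    have h₁ := hlow 0 1 zero_le_one
    have h₂ := hupp 0 1 zero_le_one
    linarith
  have hM : 0 < M := hm.trans_le hmM
  have hlip : ∀ x y, |(M * x + h x) - (M * y + h y)| ≤ (M - m) * |x - y| := by
    have key : ∀ x y, x ≤ y → |(M * x + h x) - (M * y + h y)| ≤ (M - m) * |x - y| := by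
      intro x y hxy
      have h₁ := hlow x y hxy
      have h₂ := hupp x y hxy
      rw [abs_sub_comm x y, abs_of_nonneg (sub_nonneg.2 hxy), abs_le]
      constructor <;> nlinarith
    intro x y
    rcases le_total x y with hxy | hxy
    · exact key x y hxy
    · rw [abs_sub_comm, abs_sub_comm x y]
      exact key y x hxy
  have hcont : Continuous fun x => M * x + h x := by
    refine (LipschitzWith.of_dist_le_mul (K := ⟨M - m, sub_nonneg.2 hmM⟩) fun x y => ?_).continuous
    exact hlip x y
  let S : Set (BoundedContinuousFunction ℝ ℝ) := {f | Function.Periodic f 1}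
  have hS : IsClosed S := by
    have : S = ⋂ t : ℝ, {f | f (t + 1) = f t} := by
      ext f
      simp [S, Function.Periodic]
    rw [this]
    exact isClosed_iInter fun t => isClosed_eq
      (continuous_eval_const (t + 1)) (continuous_eval_const t)
  have : CompleteSpace S := hS.completeSpace_coe
  have : Nonempty S := ⟨⟨0, fun t => rfl⟩⟩
  have hex : ∀ f : S, ∃ x : S,
      ∀ t, HasDerivAt x.1 (-M * x.1 t + (M * f.1 t + h (f.1 t) + g t)) t := by
    intro f
    obtain ⟨x, hxp, hxd⟩ := exists_periodic_solution_linear hM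
      (G := fun t => M * f.1 t + h (f.1 t) + g t)
      ((hcont.comp f.1.continuous).add hg) fun t => by
        simp only [hp t, f.2 t]
    have hxc : Continuous x := continuous_iff_continuousAt.2 fun t => (hxd t).continuousAt
    obtain ⟨C, hC⟩ := (hxp.compact_of_continuous one_ne_zero hxc).isBounded.exists_norm_le
    exact ⟨⟨.ofNormedAddCommGroup x hxc C fun t => hC _ (mem_range_self t), hxp⟩, hxd⟩
  choose T hT using hex
  have hlt : (M - m) / M < 1 := by
    rw [div_lt_one hM]
    linarith
  have hnn : 0 ≤ (M - m) / M := div_nonneg (sub_nonneg.2 hmM) hM.le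
  have hcontr : ContractingWith ⟨(M - m) / M, hnn⟩ T := by
    refine ⟨hlt, LipschitzWith.of_dist_le_mul fun f₁ f₂ => ?_⟩
    change dist (T f₁).1 (T f₂).1 ≤ (M - m) / M * dist f₁.1 f₂.1
    rw [BoundedContinuousFunction.dist_le (mul_nonneg hnn dist_nonneg)]
    intro t
    rw [div_mul_eq_mul_div, Real.dist_eq]
    refine abs_le_of_periodic_linear (x := fun t => (T f₁).1 t - (T f₂).1 t)
      (G := fun t => (M * f₁.1 t + h (f₁.1 t)) - (M * f₂.1 t + h (f₂.1 t))) hM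
      (fun t => by simp only [(T f₁).2 t, (T f₂).2 t])
      (fun t => ((hT f₁ t).sub (hT f₂ t)).congr_deriv (by ring))
      (fun t => (hlip _ _).trans ?_) t
    exact mul_le_mul_of_nonneg_left (f₁.1.dist_coe_le_dist (g := f₂.1) t)
      (sub_nonneg.2 hmM)
  obtain ⟨f, hf⟩ : ∃ f, T f = f := ⟨_, hcontr.fixedPoint_isFixedPt⟩
  refine ⟨f.1, f.2, fun t => ?_⟩
  have := hT f t
  rw [hf] at this
  exact this.congr_deriv (by ring)

/-- For a `1`-periodic forcing `g` with `|g| ≤ B < 2 / (3√3)`, the equation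
`x' = c (x - x³ + g t)` has a `1`-periodic solution lying above `1 / √3`. -/
theorem exists_upper_periodic_solution {B c : ℝ} (hc : 0 < c) (hB : B < 2 / (3 * √3))
    {g : ℝ → ℝ} (hg : Continuous g) (hp : Function.Periodic g 1) (hgB : ∀ t, |g t| ≤ B) :
    ∃ x : ℝ → ℝ, Function.Periodic x 1 ∧ (∀ t, HasDerivAt x (c * (x t - x t ^ 3 + g t)) t) ∧
      ∀ t, 1 / √3 < x t := by
  have h3 : √3 ^ 2 = 3 := sq_sqrt (by norm_num)
  have h3pos : 0 < √3 := by positivity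
  have h3one : 1 < √3 := by nlinarith
  have hB1 : B < 1 := hB.trans ((div_lt_one (by positivity)).2 (by linarith))
  obtain ⟨s, ⟨hs1, hs2⟩, hsB⟩ : ∃ s, (1 / √3 < s ∧ s < 1) ∧ B < s - s ^ 3 := by
    have hcrit : B < 1 / √3 - (1 / √3) ^ 3 := by
      convert hB using 1
      field_simp
      linarith
    have hcont : ContinuousAt (fun s : ℝ => s - s ^ 3) (1 / √3) := by fun_prop
    have hev := (hcont.eventually_const_lt hcrit).filter_mono
      (nhdsWithin_le_nhds (s := Ioi (1 / √3)))
    have hlt : 1 / √3 < 1 := (div_lt_one h3pos).2 h3one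
    obtain ⟨s, hs, hs'⟩ := ((eventually_mem_set.2 (Ioo_mem_nhdsGT hlt)).and hev).exists
    exact ⟨s, hs, hs'⟩
  have hspos : 0 < s := (by positivity : 0 < 1 / √3).trans hs1
  have hssq : 1 < 3 * s ^ 2 := by
    have : (1 / √3) ^ 2 < s ^ 2 := pow_lt_pow_left₀ hs1 (by positivity) two_ne_zero
    rw [div_pow, h3] at this
    linarith
  let p : ℝ → ℝ := fun x => max s (min 2 x)
  have hps : ∀ x, s ≤ p x := fun x => le_max_left _ _
  have hp2 : ∀ x, p x ≤ 2 := fun x => max_le (by linarith) (min_le_left _ _)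
  have hpmono : ∀ x y, x ≤ y → p x ≤ p y := fun x y hxy =>
    max_le_max le_rfl (min_le_min le_rfl hxy)
  have hplip : ∀ x y, x ≤ y → p y - p x ≤ y - x := by
    intro x y hxy
    simp only [p]
    grind
  set m := min 1 (3 * s ^ 2 - 1)
  have hm1 : m ≤ 1 := min_le_left _ _
  have hms : m ≤ 3 * s ^ 2 - 1 := min_le_right _ _
  have hmpos : 0 < m := lt_min one_pos (by linarith)
  obtain ⟨x, hxp, hxd⟩ := exists_periodic_solution_of_decreasing (m := c * m) (M := c * 11)
    (h := fun x => c * (p x - p x ^ 3 - (x - p x))) (g := fun t => c * g t) (mul_pos hc hmpos)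
    (fun x y hxy => by
      have h₁ := hps x
      have h₂ := hps y
      have h₃ : m ≤ p x ^ 2 + p x * p y + p y ^ 2 - 1 := by nlinarith
      have h₄ := hpmono x y hxy
      have h₅ := hplip x y hxy
      rw [mul_assoc, ← mul_sub]
      refine mul_le_mul_of_nonneg_left ?_ hc.le
      nlinarith [mul_le_mul_of_nonneg_left h₃ (sub_nonneg.2 h₄),
        mul_le_mul_of_nonneg_left hm1 (sub_nonneg.2 h₅)])
    (fun x y hxy => by
      have h₁ := hps x
      have h₂ := hps y
      have h₁' := hp2 x
      have h₂' := hp2 y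
      have h₃ : p x ^ 2 + p x * p y + p y ^ 2 - 1 ≤ 11 := by nlinarith
      have h₄ := hpmono x y hxy
      have h₅ := hplip x y hxy
      rw [mul_assoc, ← mul_sub]
      refine mul_le_mul_of_nonneg_left ?_ hc.le
      nlinarith [mul_le_mul_of_nonneg_left h₃ (sub_nonneg.2 h₄)])
    (hg.const_mul c) (fun t => by simp only [hp t])
  have hfield : ∀ t, c * (p (x t) - p (x t) ^ 3 - (x t - p (x t))) + c * g t = 0 →
      p (x t) - p (x t) ^ 3 - (x t - p (x t)) + g t = 0 := fun t ht => by
    rw [← mul_add] at ht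
    exact (mul_eq_zero.1 ht).resolve_left hc.ne'
  have hxs : ∀ t, s ≤ x t := by
    obtain ⟨a, ha, ha'⟩ := hxp.exists_forall_ge_of_hasDerivAt hxd
    refine fun t => le_trans ?_ (ha t)
    by_contra! hlt
    have hpa : p (x a) = s := max_eq_left ((min_le_right _ _).trans hlt.le)
    have := hfield a ha'
    rw [hpa] at this
    linarith [(abs_le.1 (hgB a)).1]
  have hx2 : ∀ t, x t ≤ 2 := by
    obtain ⟨a, ha, ha'⟩ := hxp.exists_forall_le_of_hasDerivAt hxd
    refine fun t => (ha t).trans ?_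
    by_contra! hlt
    have hpa : p (x a) = 2 := by
      simp only [p, min_eq_left hlt.le]
      exact max_eq_right (by linarith)
    have := hfield a ha'
    rw [hpa] at this
    linarith [(abs_le.1 (hgB a)).2]
  refine ⟨x, hxp, fun t => ?_, fun t => hs1.trans_le (hxs t)⟩
  have hpx : p (x t) = x t := by
    simp only [p, min_eq_right (hx2 t), max_eq_right (hxs t)]
  convert hxd t using 1
  rw [hpx]
  ring

/-- The averaged linearization is negative along a curve lying above `1 / √3`. -/
theorem integral_one_sub_three_mul_sq_neg {x : ℝ → ℝ} (hx : Continuous x)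
    (hlow : ∀ t, 1 / √3 < x t) : (∫ t in (0 : ℝ)..1, (1 - 3 * x t ^ 2)) < 0 := by
  rw [← neg_pos, ← intervalIntegral.integral_neg]
  refine intervalIntegral.intervalIntegral_pos_of_pos
    (Continuous.intervalIntegrable (by fun_prop) 0 1) (fun t => ?_) one_pos
  have : (1 / √3) ^ 2 < x t ^ 2 := pow_lt_pow_left₀ (hlow t) (by positivity) two_ne_zero
  rw [div_pow, sq_sqrt (by norm_num)] at this
  linarith

/-- Two stable periodic solutions in region `R₁`.
If `α > 0`, `A > 0` and `α + A < 2/(3√3)` (region `R₁`), then for every `ε > 0` the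
equation `ẋ = (1/ε)(x - x³ + α + A cos(2πt))` has two distinct 1-periodic solutions
`x_l* < x_u*`, each stable: each satisfies `∫₀¹ (1 - 3x*(t)²) dt < 0`, so its Floquet
multiplier `exp((1/ε) ∫₀¹ f_x(x*(t),t) dt)` is strictly less than `1`. -/
theorem two_stable_periodic_solutions_R1 (α A : ℝ) (hα : 0 < α) (hA : 0 < A)
    (hR1 : α + A < 2 / (3 * Real.sqrt 3)) :
    ∀ ε : ℝ, 0 < ε →
      ∃ xl xu : ℝ → ℝ,
        (∀ t : ℝ, HasDerivAt xl (1 / ε * fdrift α A (xl t) t) t) ∧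
        (∀ t : ℝ, xl (t + 1) = xl t) ∧
        (∀ t : ℝ, HasDerivAt xu (1 / ε * fdrift α A (xu t) t) t) ∧
        (∀ t : ℝ, xu (t + 1) = xu t) ∧
        (∀ t : ℝ, xl t < xu t) ∧
        (∫ t in (0 : ℝ)..1, (1 - 3 * xl t ^ 2)) < 0 ∧
        (∫ t in (0 : ℝ)..1, (1 - 3 * xu t ^ 2)) < 0 ∧
        Real.exp (1 / ε * ∫ t in (0 : ℝ)..1, (1 - 3 * xl t ^ 2)) < 1 ∧
        Real.exp (1 / ε * ∫ t in (0 : ℝ)..1, (1 - 3 * xu t ^ 2)) < 1 := by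
  intro ε hε
  have hcos : ∀ t, |α + A * cos (2 * π * t)| ≤ α + A := fun t => by
    have h₁ := neg_one_le_cos (2 * π * t)
    have h₂ := cos_le_one (2 * π * t)
    rw [abs_le]
    constructor <;> nlinarith
  have hgc : Continuous fun t => α + A * cos (2 * π * t) := by fun_prop
  have hgp : Function.Periodic (fun t => α + A * cos (2 * π * t)) 1 := fun t => by
    simp only [mul_add, mul_one, cos_add_two_pi]
  have hinv : 0 < 1 / ε := one_div_pos.2 hε
  obtain ⟨xu, hup, hud, hus⟩ := exists_upper_periodic_solution hinv hR1 hgc hgp hcos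
  obtain ⟨y, hyp, hyd, hys⟩ := exists_upper_periodic_solution hinv hR1 hgc.neg
    (fun t => congrArg Neg.neg (hgp t)) fun t => (abs_neg _).trans_le (hcos t)
  have huI := integral_one_sub_three_mul_sq_neg
    (continuous_iff_continuousAt.2 fun t => (hud t).continuousAt) hus
  have hlI : (∫ t in (0 : ℝ)..1, (1 - 3 * (-y t) ^ 2)) < 0 := by
    simpa only [neg_sq] using integral_one_sub_three_mul_sq_neg
      (continuous_iff_continuousAt.2 fun t => (hyd t).continuousAt) hys
  refine ⟨fun t => -y t, xu, fun t => ?_, fun t => congrArg Neg.neg (hyp t), fun t => ?_, hup,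
    fun t => ?_, hlI, huI, exp_lt_one_iff.2 (mul_neg_of_pos_of_neg hinv hlI),
    exp_lt_one_iff.2 (mul_neg_of_pos_of_neg hinv huI)⟩
  · exact (hyd t).neg.congr_deriv (by simp only [fdrift, Pi.neg_apply]; ring)
  · exact (hud t).congr_deriv (by simp only [fdrift]; ring)
  · have : 0 < 1 / √3 := by positivity
    linarith [hys t, hus t]
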